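/- Fix an increasing sequence (k_n)_{n≥1} of positive integers with k_n ≤ n for all n and k_n → ∞. Let A_n be the number of equivalence classes of tautologies of size n using at most k_n distinct variables and ST_n the number of equivalence classes of simple tautologies of size n using at most k_n distinct variables. Then ST_n/A_n → 1 as n → ∞; that is, asymptotically almost all tautologies are simple tautologies. -/

import Mathlib

open Filter

namespace CatalanSat

/-- A logical connective: `and` or `or`. -/
inductive Conn : Type
  | and : Conn
  | or : Conn

/-- An and/or tree: a binary plane tree with internal nodes labelled by a
connective and leaves labelled by a literal `(v, b)`: variable `v`, positive
if `b = true`, negated if `b = false`. -/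
inductive AOTree : Type
  | leaf (v : ℕ) (b : Bool) : AOTree
  | node (c : Conn) (l r : AOTree) : AOTree

namespace AOTree

/-- The list of leaf labels (variable index, polarity), from left to right. -/
def leaves : AOTree → List (ℕ × Bool)
  | .leaf v b => [(v, b)]
  | .node _ l r => leaves l ++ leaves r

/-- The size of an and/or tree is its number of leaves. -/
def size (t : AOTree) : ℕ := t.leaves.length

/-- The number of distinct variables appearing as leaf labels. -/
def varCount (t : AOTree) : ℕ := (t.leaves.map Prod.fst).toFinset.card

/-- The Boolean function computed by an and/or tree. -/
def eval : AOTree → (ℕ → Bool) → Bool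
  | .leaf v b, x => if b then x v else !(x v)
  | .node .and l r, x => eval l x && eval r x
  | .node .or l r, x => eval l x || eval r x

end AOTree

/-- A tree-structure: a binary plane tree with internal nodes labelled by a
connective and unlabelled leaves. -/
inductive Shape : Type
  | leaf : Shape
  | node (c : Conn) (l r : Shape) : Shape

/-- The size of a tree-structure is its number of leaves. -/
def Shape.size : Shape → ℕ
  | .leaf => 1
  | .node _ l r => Shape.size l + Shape.size r

/-- The tree-structure of an and/or tree (forget the leaf labels). -/
def AOTree.shape : AOTree → Shape
  | .leaf _ _ => .leaf
  | .node c l r => .node c l.shape r.shape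

/-- The label of the `i`-th leaf (junk default when out of range). -/
def lv (t : AOTree) (i : ℕ) : ℕ × Bool := t.leaves.getD i (0, true)

/-- Two and/or trees are equivalent when they have the same tree-structure,
two leaves are labelled by the same variable in one iff they are in the other,
and two leaves are labelled by the same literal in one iff they are in the other. -/
def TreeEquiv (A B : AOTree) : Prop :=
  A.shape = B.shape ∧
  ∀ i j : ℕ, i < A.leaves.length → j < A.leaves.length →
    (((lv A i).1 = (lv A j).1) ↔ ((lv B i).1 = (lv B j).1)) ∧
    ((lv A i = lv A j) ↔ (lv B i = lv B j))

/-- The equivalence relation on Boolean functions induced by equivalence of trees. -/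
def FunEquiv (f g : (ℕ → Bool) → Bool) : Prop :=
  ∃ A B : AOTree, TreeEquiv A B ∧ A.eval = f ∧ B.eval = g

/-- The number of equivalence classes of and/or trees satisfying a property
(the property being assumed invariant under equivalence). -/
noncomputable def classCount (P : AOTree → Prop) : ℕ :=
  Nat.card (Quot (fun A B : {t : AOTree // P t} => TreeEquiv A.1 B.1))

/-- `Tcount n K`: number of equivalence classes of and/or trees of size `n`
using at most `K` distinct variables. -/
noncomputable def Tcount (n K : ℕ) : ℕ := classCount fun t => t.size = n ∧ t.varCount ≤ K

/-- Number of such classes computing a function of the class `⟨f⟩`. -/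
noncomputable def TcountClass (n K : ℕ) (f : (ℕ → Bool) → Bool) : ℕ :=
  classCount fun t => t.size = n ∧ t.varCount ≤ K ∧ FunEquiv t.eval f

/-- `P_n⟨f⟩`: the probability that a uniform equivalence class of trees of size
`n` (at most `K` variables) computes a function of `⟨f⟩`. -/
noncomputable def Pclass (n K : ℕ) (f : (ℕ → Bool) → Bool) : ℝ :=
  (TcountClass n K f : ℝ) / (Tcount n K : ℝ)

/-- Number of classes of size `n`, at most `K` variables, computing exactly `f`. -/
noncomputable def TcountEval (n K : ℕ) (f : (ℕ → Bool) → Bool) : ℕ :=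
  classCount fun t => t.size = n ∧ t.varCount ≤ K ∧ t.eval = f

/-- Stirling numbers of the second kind. -/
def stirling : ℕ → ℕ → ℕ
  | 0, 0 => 1
  | 0, _ + 1 => 0
  | _ + 1, 0 => 0
  | n + 1, k + 1 => (k + 1) * stirling n (k + 1) + stirling n k

/-- `B n k = Σ_{p=1}^{k} S(n,p)·2^{−p}`. -/
noncomputable def B (n k : ℕ) : ℝ :=
  ∑ p ∈ Finset.Icc 1 k, (stirling n p : ℝ) / 2 ^ p

/-- `a n p = p^n/(p!·2^p)`. -/
noncomputable def a (n p : ℕ) : ℝ :=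
  (p : ℝ) ^ n / ((Nat.factorial p : ℝ) * 2 ^ p)

/-- `rat_n = B_{n−1,k_n}/B_{n,k_n}`. -/
noncomputable def rat (k : ℕ → ℕ) (n : ℕ) : ℝ := B (n - 1) (k n) / B n (k n)

/-- The complexity `L(f)`: minimal size of an and/or tree computing `f`. -/
noncomputable def complexity (f : (ℕ → Bool) → Bool) : ℕ :=
  sInf {m | ∃ t : AOTree, t.size = m ∧ t.eval = f}

/-- The variable `x_i` is essential for `f`. -/
def Essential (i : ℕ) (f : (ℕ → Bool) → Bool) : Prop :=
  ∃ x : ℕ → Bool, f (Function.update x i false) ≠ f (Function.update x i true)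

/-- `E(f)`: the number of essential variables of `f`. -/
noncomputable def essCount (f : (ℕ → Bool) → Bool) : ℕ :=
  Nat.card {i : ℕ // Essential i f}

/-- The multiplicity `R⟨f⟩ = L⟨f⟩ − E⟨f⟩`. -/
noncomputable def mult (f : (ℕ → Bool) → Bool) : ℕ := complexity f - essCount f

/-- `M` is, for each `n ≥ 1`, an index of `{1,…,n}` maximizing `p ↦ p^n/(p!·2^p)`. -/
def IsArgmax (M : ℕ → ℕ) : Prop :=
  ∀ n, 1 ≤ n → M n ∈ Finset.Icc 1 n ∧ ∀ p ∈ Finset.Icc 1 n, a n p ≤ a n (M n)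

/-- There is a leaf labelled by the given literal linked to the root by
`∨`-labelled internal nodes only. -/
def orLeaf : AOTree → ℕ × Bool → Prop
  | .leaf v b, l => (v, b) = l
  | .node .or A B, l => orLeaf A l ∨ orLeaf B l
  | .node .and _ _, _ => False

/-- There is a leaf labelled by the given literal linked to the root by
`∧`-labelled internal nodes only. -/
def andLeaf : AOTree → ℕ × Bool → Prop
  | .leaf v b, l => (v, b) = l
  | .node .and A B, l => andLeaf A l ∨ andLeaf B l
  | .node .or _ _, _ => False

/-- A simple tautology: two leaves labelled by a variable and its negation,
both linked to the root through `∨`-connectives only. -/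
def IsSimpleTautology (t : AOTree) : Prop :=
  ∃ v b, orLeaf t (v, b) ∧ orLeaf t (v, !b)

/-- A simple contradiction: the dual notion. -/
def IsSimpleContradiction (t : AOTree) : Prop :=
  ∃ v b, andLeaf t (v, b) ∧ andLeaf t (v, !b)

/-- A tautology: a tree computing the constant function `true`. -/
def IsTautology (t : AOTree) : Prop := ∀ x : ℕ → Bool, t.eval x = true

/-- A simple-x of type T: one subtree of the root is a single leaf, the other
is a simple tautology if the root is `∧`, a simple contradiction if it is `∨`. -/
def IsSimpleXT (t : AOTree) : Prop :=
  (∃ v b s, (t = .node .and (.leaf v b) s ∨ t = .node .and s (.leaf v b)) ∧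
    IsSimpleTautology s) ∨
  (∃ v b s, (t = .node .or (.leaf v b) s ∨ t = .node .or s (.leaf v b)) ∧
    IsSimpleContradiction s)

/-- A simple-x of type X: one subtree of the root is a single leaf `ℓ`, the root
is `∧` (resp. `∨`), and the other subtree has a leaf labelled by the literal of
`ℓ` linked to its root by `∨`-only (resp. `∧`-only) internal nodes. -/
def IsSimpleXX (t : AOTree) : Prop :=
  (∃ v b s, (t = .node .and (.leaf v b) s ∨ t = .node .and s (.leaf v b)) ∧
    orLeaf s (v, b)) ∨
  (∃ v b s, (t = .node .or (.leaf v b) s ∨ t = .node .or s (.leaf v b)) ∧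
    andLeaf s (v, b))

theorem Shape.size_pos (s : Shape) : 0 < s.size := by
  induction s with
  | leaf => simp [Shape.size]
  | node c l r hl hr => simp only [Shape.size]; omega

theorem Shape.finite_size (n : ℕ) : {s : Shape | s.size = n}.Finite := by
  induction n using Nat.strong_induction_on with
  | _ n ih =>
    have hfin : ∀ i : Fin n, {s : Shape | s.size = (i : ℕ)}.Finite := fun i => ih i i.2
    have key : (⋃ i : Fin n, {s : Shape | s.size = (i : ℕ)}).Finite := Set.finite_iUnion hfin
    refine (((Set.finite_singleton Shape.leaf).union
      ((key.prod key).image fun p => Shape.node .or p.1 p.2)).union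
      ((key.prod key).image fun p => Shape.node .and p.1 p.2)).subset ?_
    rintro (_ | ⟨c, l, r⟩) hs
    · simp
    · have h1 := l.size_pos
      have h2 := r.size_pos
      have hs' : l.size + r.size = n := hs
      have hl : l ∈ ⋃ i : Fin n, {s : Shape | s.size = (i : ℕ)} :=
        Set.mem_iUnion.2 ⟨⟨l.size, by omega⟩, rfl⟩
      have hr : r ∈ ⋃ i : Fin n, {s : Shape | s.size = (i : ℕ)} :=
        Set.mem_iUnion.2 ⟨⟨r.size, by omega⟩, rfl⟩
      cases c
      · exact Or.inr ⟨(l, r), ⟨hl, hr⟩, rfl⟩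
      · exact Or.inl (Or.inr ⟨(l, r), ⟨hl, hr⟩, rfl⟩)

/-- The finite set of tree-structures with `n` leaves. -/
noncomputable def shapesOfSize (n : ℕ) : Finset Shape := (Shape.finite_size n).toFinset

@[simp] theorem mem_shapesOfSize {n : ℕ} {s : Shape} : s ∈ shapesOfSize n ↔ s.size = n := by
  simp [shapesOfSize]

theorem shapesOfSize_zero : shapesOfSize 0 = ∅ := by
  ext s
  have := s.size_pos
  simp only [mem_shapesOfSize, Finset.notMem_empty, iff_false]
  omega

theorem shapesOfSize_one : shapesOfSize 1 = {Shape.leaf} := by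
  ext s
  rcases s with _ | ⟨c, l, r⟩
  · simp [Shape.size]
  · have := l.size_pos
    have := r.size_pos
    simp only [mem_shapesOfSize, Shape.size, Finset.mem_singleton, reduceCtorEq, iff_false]
    omega

theorem sum_shapesOfSize (f : Shape → ℝ) (n : ℕ) :
    ∑ s ∈ shapesOfSize n, f s = (if n = 1 then f .leaf else 0) +
      ∑ p ∈ Finset.HasAntidiagonal.antidiagonal n, ∑ l ∈ shapesOfSize p.1, ∑ r ∈ shapesOfSize p.2,
        (f (.node .or l r) + f (.node .and l r)) := by
  by_cases hn : n = 1
  · subst hn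
    simp [shapesOfSize_one, Finset.Nat.antidiagonal_succ, shapesOfSize_zero]
  · simp only [hn, if_false, zero_add]
    have : ∀ l r : Shape, f (.node .or l r) + f (.node .and l r) =
        ∑ c : Bool, f (.node (bif c then .or else .and) l r) := by
      intro l r; simp
    simp only [this, Finset.sum_sigma']
    symm
    refine Finset.sum_bij (fun x _ => .node (bif x.2.2.2 then .or else .and) x.2.1 x.2.2.1)
      ?_ ?_ ?_ ?_
    · rintro ⟨p, l, r, c⟩ h
      simp only [Finset.mem_sigma, Finset.HasAntidiagonal.mem_antidiagonal, mem_shapesOfSize] at h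
      simp only [mem_shapesOfSize, Shape.size]
      omega
    · rintro ⟨⟨p, q⟩, l, r, c⟩ h ⟨⟨p', q'⟩, l', r', c'⟩ h' heq
      simp only [Finset.mem_sigma, Finset.HasAntidiagonal.mem_antidiagonal,
        mem_shapesOfSize] at h h'
      simp only [Shape.node.injEq] at heq
      obtain ⟨hc, rfl, rfl⟩ := heq
      obtain ⟨-, rfl, rfl, -⟩ := h
      obtain ⟨-, rfl, rfl, -⟩ := h'
      cases c <;> cases c' <;> simp_all
    · rintro (_ | ⟨c, l, r⟩) h
      · simp only [mem_shapesOfSize, Shape.size] at h; omega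
      · simp only [mem_shapesOfSize, Shape.size] at h
        refine ⟨⟨(l.size, r.size), l, r, match c with | .or => true | .and => false⟩, ?_, ?_⟩
        · simp [h]
        · cases c <;> rfl
    · rintro ⟨p, l, r, c⟩ h
      rfl

/-- The number of tree-structures with `n` leaves, as a real number. -/
noncomputable def shapeCount (n : ℕ) : ℝ := (shapesOfSize n).card

theorem shapeCount_nonneg (n : ℕ) : 0 ≤ shapeCount n := Nat.cast_nonneg _

theorem shapeCount_zero : shapeCount 0 = 0 := by simp [shapeCount, shapesOfSize_zero]

theorem shapeCount_one : shapeCount 1 = 1 := by simp [shapeCount, shapesOfSize_one]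

theorem shapeCount_eq_sum (n : ℕ) :
    shapeCount n = (if n = 1 then 1 else 0) +
      2 * ∑ p ∈ Finset.HasAntidiagonal.antidiagonal n, shapeCount p.1 * shapeCount p.2 := by
  have := sum_shapesOfSize (fun _ => 1) n
  simp only [Finset.sum_const, nsmul_eq_mul, mul_one] at this
  rw [shapeCount, this, Finset.mul_sum]
  congr 1
  refine Finset.sum_congr rfl fun p _ => ?_
  simp only [shapeCount]
  ring

theorem shapeCount_succ (n : ℕ) : shapeCount (n + 1) = catalan n * 2 ^ n := by
  induction n using Nat.strong_induction_on with
  | _ n ih =>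
    rcases n with _ | n
    · simp [shapeCount_one]
    · rw [shapeCount_eq_sum, if_neg (by omega), Finset.Nat.antidiagonal_succ_succ', catalan_succ']
      simp only [Finset.sum_cons, Finset.sum_map, shapeCount_zero]
      push_cast
      simp only [zero_mul, mul_zero, zero_add, Finset.mul_sum, Finset.sum_mul]
      refine Finset.sum_congr rfl fun p hp => ?_
      rw [Finset.HasAntidiagonal.mem_antidiagonal] at hp
      simp only [Function.Embedding.prodMap, Function.Embedding.coeFn_mk, Prod.map,
        Nat.succ_eq_add_one]
      rw [ih p.1 (by omega), ih p.2 (by omega), ← hp]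
      ring

theorem shapeCount_pos (n : ℕ) : 0 < shapeCount (n + 1) := by
  have h := succ_mul_catalan_eq_centralBinom n
  have h2 := Nat.centralBinom_pos n
  have : 0 < catalan n := Nat.pos_of_ne_zero fun h0 => by simp [h0] at h; omega
  rw [shapeCount_succ]
  positivity

theorem shapeCount_rec (n : ℕ) :
    ((n : ℝ) + 2) * shapeCount (n + 2) = 4 * (2 * n + 1) * shapeCount (n + 1) := by
  have h : (n + 2) * catalan (n + 1) = 2 * (2 * n + 1) * catalan n := by
    have h1 := succ_mul_catalan_eq_centralBinom n
    have h2 := succ_mul_catalan_eq_centralBinom (n + 1)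
    have h3 := Nat.succ_mul_centralBinom_succ n
    rw [← h1, ← h2] at h3
    refine Nat.eq_of_mul_eq_mul_left (Nat.succ_pos n) ?_
    rw [Nat.succ_eq_add_one]
    linarith
  have h' : ((n : ℝ) + 2) * catalan (n + 1) = 2 * (2 * n + 1) * catalan n := by exact_mod_cast h
  rw [show n + 2 = (n + 1) + 1 from rfl, shapeCount_succ, shapeCount_succ, pow_succ]
  linear_combination 2 * 2 ^ n * h'

theorem shapeCount_le_mul (n : ℕ) : shapeCount (n + 2) ≤ 8 * shapeCount (n + 1) := by
  have h := shapeCount_rec n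
  have h0 := shapeCount_nonneg (n + 1)
  have : ((n : ℝ) + 2) * shapeCount (n + 2) ≤ (n + 2) * (8 * shapeCount (n + 1)) := by
    rw [h]; nlinarith
  exact le_of_mul_le_mul_left this (by positivity)

/-- The generating function of tree-structures. -/
noncomputable def shapeSeries : PowerSeries ℝ := PowerSeries.mk shapeCount

theorem shapeSeries_eq : shapeSeries = PowerSeries.X + 2 * shapeSeries ^ 2 := by
  ext n
  have : (2 : PowerSeries ℝ) = PowerSeries.C 2 := (map_ofNat PowerSeries.C 2).symm
  rw [map_add, this, PowerSeries.coeff_C_mul, sq, PowerSeries.coeff_mul, PowerSeries.coeff_X]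
  simp only [shapeSeries, PowerSeries.coeff_mk]
  exact shapeCount_eq_sum n

theorem coeff_shapeSeries_pow_le (m n : ℕ) :
    0 ≤ PowerSeries.coeff n (shapeSeries ^ (m + 1)) ∧
      PowerSeries.coeff n (shapeSeries ^ (m + 1)) ≤ shapeCount n := by
  induction m generalizing n with
  | zero => simp [shapeSeries, shapeCount_nonneg]
  | succ m ih =>
    rw [pow_succ, PowerSeries.coeff_mul]
    simp only [shapeSeries, PowerSeries.coeff_mk] at ih ⊢
    refine ⟨Finset.sum_nonneg fun p _ => mul_nonneg (ih _).1 (shapeCount_nonneg _), ?_⟩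
    have h := shapeCount_eq_sum n
    have h1 : ∑ p ∈ Finset.HasAntidiagonal.antidiagonal n, (PowerSeries.coeff p.1)
        (PowerSeries.mk shapeCount ^ (m + 1)) * shapeCount p.2 ≤
        ∑ p ∈ Finset.HasAntidiagonal.antidiagonal n, shapeCount p.1 * shapeCount p.2 :=
      Finset.sum_le_sum fun p _ => mul_le_mul_of_nonneg_right (ih _).2 (shapeCount_nonneg _)
    have h2 : 0 ≤ ∑ p ∈ Finset.HasAntidiagonal.antidiagonal n, shapeCount p.1 * shapeCount p.2 :=
      Finset.sum_nonneg fun p _ => mul_nonneg (shapeCount_nonneg _) (shapeCount_nonneg _)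
    split_ifs at h <;> linarith

theorem coeff_shapeSeries_pow_five_le (n : ℕ) :
    16 * PowerSeries.coeff n (shapeSeries ^ 5) ≤ 5 * PowerSeries.coeff n (shapeSeries ^ 4) := by
  have hT := shapeSeries_eq
  have h8 : 8 * (5 * shapeSeries ^ 4 - 16 * shapeSeries ^ 5) =
      -3 * shapeSeries + 28 * (PowerSeries.X * shapeSeries)
        - 32 * (PowerSeries.X * (PowerSeries.X * shapeSeries))
        + 3 * PowerSeries.X - 22 * (PowerSeries.X * PowerSeries.X) := by
    have hX : (PowerSeries.X : PowerSeries ℝ) = shapeSeries - 2 * shapeSeries ^ 2 :=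
      eq_sub_of_add_eq hT.symm
    rw [hX]
    ring
  have hc := congrArg (PowerSeries.coeff n) h8
  have e8 : (8 : PowerSeries ℝ) = PowerSeries.C 8 := (map_ofNat PowerSeries.C 8).symm
  have e5 : (5 : PowerSeries ℝ) = PowerSeries.C 5 := (map_ofNat PowerSeries.C 5).symm
  have e16 : (16 : PowerSeries ℝ) = PowerSeries.C 16 := (map_ofNat PowerSeries.C 16).symm
  have e3 : (3 : PowerSeries ℝ) = PowerSeries.C 3 := (map_ofNat PowerSeries.C 3).symm
  have e28 : (28 : PowerSeries ℝ) = PowerSeries.C 28 := (map_ofNat PowerSeries.C 28).symm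
  have e32 : (32 : PowerSeries ℝ) = PowerSeries.C 32 := (map_ofNat PowerSeries.C 32).symm
  have e22 : (22 : PowerSeries ℝ) = PowerSeries.C 22 := (map_ofNat PowerSeries.C 22).symm
  rw [e8, e5, e16, e3, e28, e32, e22, ← map_neg] at hc
  simp only [map_add, map_sub, PowerSeries.coeff_C_mul] at hc
  suffices h : 0 ≤ (8 : ℝ) * (5 * PowerSeries.coeff n (shapeSeries ^ 4) -
      16 * PowerSeries.coeff n (shapeSeries ^ 5)) by linarith
  rw [hc]
  rcases n with _ | _ | _ | n
  · simp [shapeSeries, shapeCount_zero]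
  · simp [shapeSeries, shapeCount_zero, shapeCount_one, PowerSeries.coeff_succ_X_mul]
  · have := shapeCount_rec 0
    simp [shapeCount_one] at this
    simp [shapeSeries, shapeCount_zero, shapeCount_one, PowerSeries.coeff_succ_X_mul,
      PowerSeries.coeff_X]
    linarith
  · have h1 := shapeCount_rec n
    have h2 := shapeCount_rec (n + 1)
    have h0 := shapeCount_nonneg (n + 1)
    simp only [PowerSeries.coeff_succ_X_mul, shapeSeries, PowerSeries.coeff_mk,
      PowerSeries.coeff_X]
    norm_num [show n + 2 ≠ 1 by omega]
    push_cast at h2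
    set x := shapeCount (n + 1)
    set y := shapeCount (n + 1 + 1)
    set z := shapeCount (n + 1 + 1 + 1)
    have hn : (0 : ℝ) ≤ n := Nat.cast_nonneg n
    have hy : y = 4 * (2 * n + 1) * x / (n + 2) := by
      field_simp; linear_combination h1
    have hz : z = 4 * (2 * n + 3) * y / (n + 3) := by
      field_simp; linear_combination h2
    have : -(3 * z) + 28 * y - 32 * x = 240 * n * x / ((n + 2) * (n + 3)) := by
      rw [hz, hy]; field_simp; ring
    have h3 : 0 ≤ 240 * n * x / ((n + 2) * (n + 3)) := by positivity
    linarith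

theorem exists_supersolution : ∃ H : ℕ → ℝ, ∃ C : ℝ, (∀ n, H n ≤ C * shapeCount n) ∧
    ∀ n, shapeCount n + 3 * ∑ p ∈ Finset.HasAntidiagonal.antidiagonal n,
      H p.1 * shapeCount p.2 ≤ H n := by
  let h : PowerSeries ℝ := shapeSeries + PowerSeries.C 3 * shapeSeries ^ 2
    + PowerSeries.C 9 * shapeSeries ^ 3 + PowerSeries.C 432 * shapeSeries ^ 4
  refine ⟨fun n => PowerSeries.coeff n h, 445, fun n => ?_, fun n => ?_⟩
  · have h1 := (coeff_shapeSeries_pow_le 0 n).2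
    have h2 := (coeff_shapeSeries_pow_le 1 n).2
    have h3 := (coeff_shapeSeries_pow_le 2 n).2
    have h4 := (coeff_shapeSeries_pow_le 3 n).2
    simp only [zero_add, pow_one, Nat.reduceAdd] at h1 h2 h3 h4
    simp only [h, map_add, PowerSeries.coeff_C_mul]
    linarith
  · have hid : shapeSeries + PowerSeries.C 3 * (h * shapeSeries) + PowerSeries.C 81 *
        (PowerSeries.C 5 * shapeSeries ^ 4 - PowerSeries.C 16 * shapeSeries ^ 5) = h := by
      simp only [h, map_ofNat]
      ring
    have hc := congrArg (PowerSeries.coeff n) hid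
    simp only [map_add, map_sub, PowerSeries.coeff_C_mul] at hc
    rw [PowerSeries.coeff_mul] at hc
    have h5 := coeff_shapeSeries_pow_five_le n
    have e : ∀ m, PowerSeries.coeff m shapeSeries = shapeCount m := by simp [shapeSeries]
    simp only [e] at hc
    simp only [h, map_add, PowerSeries.coeff_C_mul] at hc ⊢
    linarith

theorem exists_bound_of_linear_recursion : ∃ C : ℝ, ∀ (F : ℕ → ℝ) (b : ℝ), 0 ≤ b →
    (∀ n, F n ≤ b * shapeCount n + 3 * ∑ p ∈ Finset.HasAntidiagonal.antidiagonal n,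
      F p.1 * shapeCount p.2) → ∀ n, F n ≤ C * b * shapeCount n := by
  obtain ⟨H, C, hHC, hH⟩ := exists_supersolution
  refine ⟨C, fun F b hb hF n => ?_⟩
  have key : ∀ n, F n ≤ b * H n := by
    intro n
    induction n using Nat.strong_induction_on with
    | _ n ih =>
      refine (hF n).trans (le_trans ?_ (mul_le_mul_of_nonneg_left (hH n) hb))
      have : ∑ p ∈ Finset.HasAntidiagonal.antidiagonal n, F p.1 * shapeCount p.2 ≤
          b * ∑ p ∈ Finset.HasAntidiagonal.antidiagonal n, H p.1 * shapeCount p.2 := by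
        rw [Finset.mul_sum]
        refine Finset.sum_le_sum fun p hp => ?_
        rw [Finset.HasAntidiagonal.mem_antidiagonal] at hp
        rcases Nat.eq_zero_or_pos p.2 with h0 | h0
        · simp [h0, shapeCount_zero]
        · rw [← mul_assoc]
          exact mul_le_mul_of_nonneg_right (ih p.1 (by omega)) (shapeCount_nonneg _)
      linarith
  calc F n ≤ b * H n := key n
    _ ≤ b * (C * shapeCount n) := mul_le_mul_of_nonneg_left (hHC n) hb
    _ = C * b * shapeCount n := by ring

/-- A nonnegative parameter of tree-structures whose mean over the tree-structures of size `n`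
is bounded uniformly in `n`. -/
def BoundedMean (f : Shape → ℝ) : Prop :=
  (∀ s, 0 ≤ f s) ∧ ∃ C : ℝ, ∀ n, ∑ s ∈ shapesOfSize n, f s ≤ C * shapeCount n

theorem BoundedMean.add {f g : Shape → ℝ} (hf : BoundedMean f) (hg : BoundedMean g) :
    BoundedMean fun s => f s + g s := by
  obtain ⟨hf0, C, hC⟩ := hf
  obtain ⟨hg0, D, hD⟩ := hg
  refine ⟨fun s => add_nonneg (hf0 s) (hg0 s), C + D, fun n => ?_⟩
  rw [Finset.sum_add_distrib, add_mul]
  exact add_le_add (hC n) (hD n)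

theorem boundedMean_one : BoundedMean fun _ => 1 :=
  ⟨fun _ => zero_le_one, 1, fun n => by simp [shapeCount]⟩

theorem sum_shapeCount_mul_le (n : ℕ) :
    ∑ p ∈ Finset.HasAntidiagonal.antidiagonal n, shapeCount p.1 * shapeCount p.2 ≤
      shapeCount n := by
  have h := shapeCount_eq_sum n
  have h2 : 0 ≤ ∑ p ∈ Finset.HasAntidiagonal.antidiagonal n, shapeCount p.1 * shapeCount p.2 :=
    Finset.sum_nonneg fun p _ => mul_nonneg (shapeCount_nonneg _) (shapeCount_nonneg _)
  split_ifs at h <;> linarith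

theorem BoundedMean.of_recursion {f g h : Shape → ℝ} {D : ℝ} (hf : ∀ s, 0 ≤ f s)
    (hg : BoundedMean g) (hh : BoundedMean h) (hD : 0 ≤ D)
    (hor : ∀ l r, f (.node .or l r) ≤ f l + f r + D * (g l * h r))
    (hand : ∀ l r, f (.node .and l r) ≤ f l + D * (g l * h r)) : BoundedMean f := by
  obtain ⟨hg0, Cg, hCg⟩ := hg
  obtain ⟨hh0, Ch, hCh⟩ := hh
  obtain ⟨C, hC⟩ := exists_bound_of_linear_recursion
  have hCg0 : 0 ≤ Cg := by
    have := hCg 1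
    simp only [shapesOfSize_one, Finset.sum_singleton, shapeCount_one, mul_one] at this
    exact (hg0 _).trans this
  have hCh0 : 0 ≤ Ch := by
    have := hCh 1
    simp only [shapesOfSize_one, Finset.sum_singleton, shapeCount_one, mul_one] at this
    exact (hh0 _).trans this
  set F : ℕ → ℝ := fun n => ∑ s ∈ shapesOfSize n, f s with hF
  set b : ℝ := f .leaf + 2 * D * (Cg * Ch) with hb
  have hb0 : 0 ≤ b := add_nonneg (hf _) (by positivity)
  refine ⟨hf, C * b, hC F b hb0 fun n => ?_⟩
  have hswap : ∑ p ∈ Finset.HasAntidiagonal.antidiagonal n, shapeCount p.1 * F p.2 =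
      ∑ p ∈ Finset.HasAntidiagonal.antidiagonal n, F p.1 * shapeCount p.2 := by
    rw [← Finset.Nat.sum_antidiagonal_swap]
    exact Finset.sum_congr rfl fun p _ => mul_comm _ _
  have hpair : ∀ p : ℕ × ℕ, ∑ l ∈ shapesOfSize p.1, ∑ r ∈ shapesOfSize p.2,
      (f (.node .or l r) + f (.node .and l r)) ≤
      2 * (F p.1 * shapeCount p.2) + shapeCount p.1 * F p.2 +
        2 * D * (Cg * Ch) * (shapeCount p.1 * shapeCount p.2) := by
    intro p
    calc _ ≤ ∑ l ∈ shapesOfSize p.1, ∑ r ∈ shapesOfSize p.2,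
          (2 * f l + f r + 2 * D * (g l * h r)) :=
          Finset.sum_le_sum fun l _ => Finset.sum_le_sum fun r _ => by
            linarith [hor l r, hand l r]
      _ = 2 * (F p.1 * shapeCount p.2) + shapeCount p.1 * F p.2 +
          2 * D * ((∑ l ∈ shapesOfSize p.1, g l) * ∑ r ∈ shapesOfSize p.2, h r) := by
          simp only [Finset.sum_add_distrib, Finset.sum_const, nsmul_eq_mul, ← Finset.mul_sum,
            ← Finset.sum_mul, hF, shapeCount]
          ring
      _ ≤ _ := by
          have : (∑ l ∈ shapesOfSize p.1, g l) * ∑ r ∈ shapesOfSize p.2, h r ≤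
              (Cg * shapeCount p.1) * (Ch * shapeCount p.2) :=
            mul_le_mul (hCg _) (hCh _) (Finset.sum_nonneg fun s _ => hh0 s)
              (mul_nonneg hCg0 (shapeCount_nonneg _))
          have := mul_le_mul_of_nonneg_left this (show 0 ≤ 2 * D by positivity)
          linarith
  have hsum := Finset.sum_le_sum fun p (_ : p ∈ Finset.HasAntidiagonal.antidiagonal n) => hpair p
  simp only [Finset.sum_add_distrib, ← Finset.mul_sum] at hsum
  rw [hswap] at hsum
  have hconv := mul_le_mul_of_nonneg_left (sum_shapeCount_mul_le n)
    (show 0 ≤ 2 * D * (Cg * Ch) by positivity)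
  have hleaf : (if n = 1 then f .leaf else 0) ≤ f .leaf * shapeCount n := by
    split_ifs with hn
    · simp [hn, shapeCount_one]
    · exact mul_nonneg (hf _) (shapeCount_nonneg _)
  have hrec := sum_shapesOfSize f n
  simp only [hF, hb] at hsum ⊢
  rw [hrec]
  simp only [Finset.sum_add_distrib] at hsum ⊢
  linarith

theorem add_pow_succ_le (j : ℕ) : ∃ D : ℝ, 0 ≤ D ∧ ∀ x y : ℝ, 1 ≤ x → 1 ≤ y →
    (x + y) ^ (j + 1) ≤ x ^ (j + 1) + y ^ (j + 1) + D * (x ^ j * y ^ j) := by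
  induction j with
  | zero => exact ⟨0, le_rfl, fun x y _ _ => by simp⟩
  | succ j ih =>
    obtain ⟨D, hD, h⟩ := ih
    refine ⟨2 * D + 2, by positivity, fun x y hx hy => ?_⟩
    have hxj : 1 ≤ x ^ j := one_le_pow₀ hx
    have hyj : 1 ≤ y ^ j := one_le_pow₀ hy
    have hxj1 : 1 ≤ x ^ j * x := one_le_mul_of_one_le_of_one_le hxj hx
    have hyj1 : 1 ≤ y ^ j * y := one_le_mul_of_one_le_of_one_le hyj hy
    have h1 := mul_le_mul_of_nonneg_left (h x y hx hy) (show 0 ≤ x + y by linarith)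
    have hp : 0 ≤ D * (x ^ j * y ^ j) := by positivity
    have h2 : (x + y) * (D * (x ^ j * y ^ j)) ≤ 2 * x * y * (D * (x ^ j * y ^ j)) :=
      mul_le_mul_of_nonneg_right (by nlinarith) hp
    have h3 : x * (y ^ j * y) ≤ (x ^ j * x) * (y ^ j * y) :=
      mul_le_mul_of_nonneg_right (le_mul_of_one_le_left (by linarith) hxj) (by linarith)
    have h4 : y * (x ^ j * x) ≤ (y ^ j * y) * (x ^ j * x) :=
      mul_le_mul_of_nonneg_right (le_mul_of_one_le_left (by linarith) hyj) (by linarith)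
    simp only [pow_succ] at h1 ⊢
    linarith

/-- The positions (shifted by the offset) of the leaves reached from the root by taking both
children of a disjunction and the left child of a conjunction. -/
def Shape.leftPattern : Shape → Finset ℕ
  | .leaf => {0}
  | .node .or l r => l.leftPattern ∪ r.leftPattern.map (addLeftEmbedding l.size)
  | .node .and l _ => l.leftPattern

/-- The positions of the leaves of `Shape.leftPattern`, together with those obtained by applying
the same pattern to the right children of the conjunctions met on the way. -/
def Shape.leftPattern₂ : Shape → Finset ℕ
  | .leaf => {0}
  | .node .or l r => l.leftPattern₂ ∪ r.leftPattern₂.map (addLeftEmbedding l.size)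
  | .node .and l r => l.leftPattern₂ ∪ r.leftPattern.map (addLeftEmbedding l.size)

theorem Shape.one_le_card_leftPattern (s : Shape) : 1 ≤ s.leftPattern.card := by
  rw [Nat.one_le_iff_ne_zero, Finset.card_ne_zero]
  induction s with
  | leaf => exact Finset.singleton_nonempty 0
  | node c l r hl hr =>
    cases c
    · exact hl
    · exact hl.mono Finset.subset_union_left

theorem Shape.one_le_card_leftPattern₂ (s : Shape) : 1 ≤ s.leftPattern₂.card := by
  rw [Nat.one_le_iff_ne_zero, Finset.card_ne_zero]
  induction s with
  | leaf => exact Finset.singleton_nonempty 0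
  | node c l r hl hr => cases c <;> exact hl.mono Finset.subset_union_left

theorem boundedMean_card_leftPattern_pow (j : ℕ) :
    BoundedMean fun s => (s.leftPattern.card : ℝ) ^ j := by
  induction j with
  | zero => simpa using boundedMean_one
  | succ j ih =>
    obtain ⟨D, hD, h⟩ := add_pow_succ_le j
    refine BoundedMean.of_recursion (fun s => by positivity) ih ih hD (fun l r => ?_)
      fun l r => ?_
    · refine le_trans ?_ (h _ _ (by exact_mod_cast l.one_le_card_leftPattern)
        (by exact_mod_cast r.one_le_card_leftPattern))
      gcongr
      have := Finset.card_union_le l.leftPattern (r.leftPattern.map (addLeftEmbedding l.size))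
      rw [Finset.card_map] at this
      exact_mod_cast this
    · exact le_add_of_nonneg_right (by positivity)

theorem boundedMean_card_leftPattern₂_pow (j : ℕ) :
    BoundedMean fun s => (s.leftPattern₂.card : ℝ) ^ j := by
  induction j with
  | zero => simpa using boundedMean_one
  | succ j ih =>
    obtain ⟨D, hD, h⟩ := add_pow_succ_le j
    refine BoundedMean.of_recursion (fun s => by positivity) ih
      (ih.add (boundedMean_card_leftPattern_pow (j + 1))) (add_nonneg hD zero_le_one)
      (fun l r => ?_) fun l r => ?_
    · have h1 := h l.leftPattern₂.card r.leftPattern₂.card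
        (by exact_mod_cast l.one_le_card_leftPattern₂)
        (by exact_mod_cast r.one_le_card_leftPattern₂)
      have h2 : ((Shape.node .or l r).leftPattern₂.card : ℝ) ^ (j + 1) ≤
          ((l.leftPattern₂.card : ℝ) + r.leftPattern₂.card) ^ (j + 1) := by
        gcongr
        have := Finset.card_union_le l.leftPattern₂ (r.leftPattern₂.map (addLeftEmbedding l.size))
        rw [Finset.card_map] at this
        exact_mod_cast this
      have h3 : 0 ≤ (l.leftPattern₂.card : ℝ) ^ j * (r.leftPattern₂.card : ℝ) ^ j := by positivity
      have h4 : 0 ≤ (D + 1) * ((l.leftPattern₂.card : ℝ) ^ j *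
        (r.leftPattern.card : ℝ) ^ (j + 1)) := by positivity
      linarith
    · have h1 := h l.leftPattern₂.card r.leftPattern.card
        (by exact_mod_cast l.one_le_card_leftPattern₂)
        (by exact_mod_cast r.one_le_card_leftPattern)
      have h2 : ((Shape.node .and l r).leftPattern₂.card : ℝ) ^ (j + 1) ≤
          ((l.leftPattern₂.card : ℝ) + r.leftPattern.card) ^ (j + 1) := by
        gcongr
        have := Finset.card_union_le l.leftPattern₂ (r.leftPattern.map (addLeftEmbedding l.size))
        rw [Finset.card_map] at this
        exact_mod_cast this
      have hl : 1 ≤ (l.leftPattern₂.card : ℝ) ^ j :=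
        one_le_pow₀ (by exact_mod_cast l.one_le_card_leftPattern₂)
      have hr : 1 ≤ (r.leftPattern.card : ℝ) := by exact_mod_cast r.one_le_card_leftPattern
      have h3 : (r.leftPattern.card : ℝ) ^ j ≤ (r.leftPattern.card : ℝ) ^ (j + 1) :=
        pow_le_pow_right₀ hr (Nat.le_succ j)
      have h4 : 0 ≤ (D + 1) * ((l.leftPattern₂.card : ℝ) ^ j *
        (r.leftPattern₂.card : ℝ) ^ j) := by positivity
      have h5 : (r.leftPattern.card : ℝ) ^ (j + 1) ≤
          (l.leftPattern₂.card : ℝ) ^ j * (r.leftPattern.card : ℝ) ^ (j + 1) :=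
        le_mul_of_one_le_left (by positivity) hl
      have h6 : D * ((l.leftPattern₂.card : ℝ) ^ j * (r.leftPattern.card : ℝ) ^ j) ≤
          D * ((l.leftPattern₂.card : ℝ) ^ j * (r.leftPattern.card : ℝ) ^ (j + 1)) := by
        gcongr
      linarith

/-- The and/or tree with tree-structure `s` and leaves labelled `v 0, v 1, …` from left to right. -/
def Shape.label : Shape → (ℕ → ℕ × Bool) → AOTree
  | .leaf, v => .leaf (v 0).1 (v 0).2
  | .node c l r, v => .node c (l.label v) (r.label fun i => v (l.size + i))

theorem Shape.leaves_label (s : Shape) (v : ℕ → ℕ × Bool) :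
    (s.label v).leaves = (List.range s.size).map v := by
  induction s generalizing v with
  | leaf => simp [Shape.label, AOTree.leaves, Shape.size]
  | node c l r hl hr =>
    simp [Shape.label, AOTree.leaves, Shape.size, hl, hr, List.range_add, Function.comp_def]

theorem Shape.size_label (s : Shape) (v : ℕ → ℕ × Bool) : (s.label v).size = s.size := by
  simp [AOTree.size, s.leaves_label]

theorem Shape.shape_label (s : Shape) (v : ℕ → ℕ × Bool) : (s.label v).shape = s := by
  induction s generalizing v with
  | leaf => rfl
  | node c l r hl hr => simp [Shape.label, AOTree.shape, hl, hr]

theorem Shape.lv_label (s : Shape) (v : ℕ → ℕ × Bool) {i : ℕ} (hi : i < s.size) :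
    lv (s.label v) i = v i := by
  simp [lv, s.leaves_label, List.getD_eq_getElem?_getD, hi]

theorem AOTree.size_shape (t : AOTree) : t.shape.size = t.size := by
  induction t with
  | leaf v b => rfl
  | node c l r hl hr =>
    simp only [AOTree.size] at hl hr
    simp [AOTree.shape, Shape.size, AOTree.size, AOTree.leaves, hl, hr]

theorem Shape.label_congr (s : Shape) {v w : ℕ → ℕ × Bool} (h : ∀ i < s.size, v i = w i) :
    s.label v = s.label w := by
  induction s generalizing v w with
  | leaf => simp [Shape.label, h 0 (by simp [Shape.size])]
  | node c l r hl hr =>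
    simp only [Shape.size] at h
    rw [Shape.label, Shape.label, hl fun i hi => h i (by omega),
      hr fun i hi => h (l.size + i) (by omega)]

theorem AOTree.label_lv (t : AOTree) : t.shape.label (lv t) = t := by
  induction t with
  | leaf v b => rfl
  | node c l r hl hr =>
    have h1 : l.shape.label (lv (.node c l r)) = l := by
      refine Eq.trans (Shape.label_congr _ fun i hi => ?_) hl
      rw [AOTree.size_shape] at hi
      exact List.getD_append _ _ _ _ hi
    have h2 : r.shape.label (fun i => lv (.node c l r) (l.shape.size + i)) = r := by
      refine Eq.trans (Shape.label_congr _ fun i hi => ?_) hr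
      rw [AOTree.size_shape]
      simp only [lv, AOTree.leaves, AOTree.size, List.getD_eq_getElem?_getD]
      rw [List.getElem?_append_right (Nat.le_add_right _ _), Nat.add_sub_cancel_left]
    rw [AOTree.shape, Shape.label, h1, h2]

theorem Shape.lt_size_of_mem_leftPattern {s : Shape} {i : ℕ} (hi : i ∈ s.leftPattern) :
    i < s.size := by
  induction s generalizing i with
  | leaf => simp_all [Shape.leftPattern, Shape.size]
  | node c l r hl hr =>
    cases c
    · have := hl hi
      simp only [Shape.size]
      omega
    · simp only [Shape.leftPattern, Finset.mem_union, Finset.mem_map, addLeftEmbedding_apply] at hi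
      simp only [Shape.size]
      rcases hi with hi | ⟨j, hj, rfl⟩
      · have := hl hi
        omega
      · have := hr hj
        omega

theorem Shape.lt_size_of_mem_leftPattern₂ {s : Shape} {i : ℕ} (hi : i ∈ s.leftPattern₂) :
    i < s.size := by
  induction s generalizing i with
  | leaf => simp_all [Shape.leftPattern₂, Shape.size]
  | node c l r hl hr =>
    simp only [Shape.size]
    cases c <;> simp only [Shape.leftPattern₂, Finset.mem_union, Finset.mem_map,
      addLeftEmbedding_apply] at hi <;> rcases hi with hi | ⟨j, hj, rfl⟩
    · have := hl hi
      omega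
    · have := lt_size_of_mem_leftPattern hj
      omega
    · have := hl hi
      omega
    · have := hr hj
      omega

theorem Shape.leftPattern_subset (s : Shape) : s.leftPattern ⊆ s.leftPattern₂ := by
  induction s with
  | leaf => exact subset_rfl
  | node c l r hl hr =>
    cases c
    · exact hl.trans Finset.subset_union_left
    · exact Finset.union_subset_union hl (Finset.map_subset_map.2 hr)

theorem Shape.eval_label_eq_false {s : Shape} {v : ℕ → ℕ × Bool} {x : ℕ → Bool}
    (h : ∀ i ∈ s.leftPattern, x (v i).1 = !(v i).2) : (s.label v).eval x = false := by
  induction s generalizing v with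
  | leaf =>
    have := h 0 (by simp [Shape.leftPattern])
    cases hb : (v 0).2 <;> simp_all [Shape.label, AOTree.eval]
  | node c l r hl hr =>
    cases c
    · simp [Shape.label, AOTree.eval, hl h]
    · simp only [Shape.leftPattern, Finset.mem_union, Finset.mem_map, addLeftEmbedding_apply] at h
      simp only [Shape.label, AOTree.eval, Bool.or_eq_false_iff]
      exact ⟨hl fun i hi => h i (Or.inl hi), hr fun i hi => h _ (Or.inr ⟨i, hi, rfl⟩)⟩

theorem Shape.eval_label_eq_false_of_not_orLeaf {s : Shape} {v : ℕ → ℕ × Bool} {x : ℕ → Bool}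
    {i₀ : ℕ} (hi₀ : i₀ ∈ s.leftPattern) (hor : ¬ orLeaf (s.label v) (v i₀))
    (h : ∀ i ∈ s.leftPattern₂, i ≠ i₀ → x (v i).1 = !(v i).2) :
    (s.label v).eval x = false := by
  induction s generalizing v i₀ with
  | leaf =>
    simp only [Shape.leftPattern, Finset.mem_singleton] at hi₀
    subst hi₀
    exact absurd rfl hor
  | node c l r hl hr =>
    cases c
    · have hlt := Shape.lt_size_of_mem_leftPattern (s := l) hi₀
      simp only [Shape.leftPattern₂, Finset.mem_union, Finset.mem_map,
        addLeftEmbedding_apply] at h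
      have : (r.label fun i => v (l.size + i)).eval x = false :=
        Shape.eval_label_eq_false fun i hi => h _ (Or.inr ⟨i, hi, rfl⟩) (by omega)
      simp [Shape.label, AOTree.eval, this]
    · simp only [Shape.leftPattern₂, Finset.mem_union, Finset.mem_map,
        addLeftEmbedding_apply] at h
      simp only [Shape.leftPattern, Finset.mem_union, Finset.mem_map,
        addLeftEmbedding_apply] at hi₀
      simp only [Shape.label, orLeaf, not_or] at hor
      simp only [Shape.label, AOTree.eval, Bool.or_eq_false_iff]
      rcases hi₀ with hi₀ | ⟨j, hj, rfl⟩
      · have hlt := Shape.lt_size_of_mem_leftPattern hi₀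
        exact ⟨hl hi₀ hor.1 fun i hi hne => h i (Or.inl hi) hne,
          Shape.eval_label_eq_false fun i hi =>
            h _ (Or.inr ⟨i, r.leftPattern_subset hi, rfl⟩) (by omega)⟩
      · refine ⟨Shape.eval_label_eq_false fun i hi => ?_, hr hj hor.2 fun i hi hne =>
          h _ (Or.inr ⟨i, hi, rfl⟩) (by omega)⟩
        have hlt := Shape.lt_size_of_mem_leftPattern hi
        exact h i (Or.inl (l.leftPattern_subset hi)) (by omega)

theorem exists_falsifying (D : Finset ℕ) (v : ℕ → ℕ × Bool)
    (h : ∀ i ∈ D, ∀ j ∈ D, (v i).1 = (v j).1 → (v i).2 = (v j).2) :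
    ∃ x : ℕ → Bool, ∀ i ∈ D, x (v i).1 = !(v i).2 := by
  classical
  refine ⟨fun u => decide (∃ i ∈ D, v i = (u, false)), fun i hi => ?_⟩
  cases hb : (v i).2
  · simp only [Bool.not_false, decide_eq_true_eq]
    exact ⟨i, hi, Prod.ext rfl hb⟩
  · simp only [Bool.not_true, decide_eq_false_iff_not]
    rintro ⟨j, hj, hv⟩
    have := h i hi j hj (by rw [hv])
    simp [hv, hb] at this

theorem exists_two_repetitions {s : Shape} {v : ℕ → ℕ × Bool}
    (htaut : IsTautology (s.label v)) (hsimple : ¬ IsSimpleTautology (s.label v)) :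
    ∃ i ∈ s.leftPattern₂, ∃ j ∈ s.leftPattern₂, ∃ k ∈ s.leftPattern₂, ∃ l ∈ s.leftPattern₂,
      i ≠ j ∧ i ≠ l ∧ k ≠ j ∧ k ≠ l ∧ j ≠ l ∧ (v i).1 = (v j).1 ∧ (v k).1 = (v l).1 := by
  have hpair : ∃ i ∈ s.leftPattern, ∃ j ∈ s.leftPattern,
      (v i).1 = (v j).1 ∧ (v i).2 ≠ (v j).2 := by
    by_contra! hcon
    obtain ⟨x, hx⟩ := exists_falsifying _ _ hcon
    have := Shape.eval_label_eq_false hx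
    rw [htaut x] at this
    exact absurd this (by decide)
  obtain ⟨i, hi, j, hj, hv, hb⟩ := hpair
  have hne : i ≠ j := fun h => hb (by rw [h])
  wlog hor : ¬ orLeaf (s.label v) (v i) generalizing i j
  · refine this j hj i hi hv.symm hb.symm hne.symm fun hor' => hsimple ?_
    rw [not_not] at hor
    refine ⟨(v i).1, (v i).2, hor, ?_⟩
    have : ((v i).1, !(v i).2) = v j := by
      refine Prod.ext hv ?_
      revert hb
      cases (v i).2 <;> cases (v j).2 <;> simp
    rwa [this]
  have hpair2 : ∃ k ∈ s.leftPattern₂.erase i, ∃ l ∈ s.leftPattern₂.erase i,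
      (v k).1 = (v l).1 ∧ (v k).2 ≠ (v l).2 := by
    by_contra! hcon
    obtain ⟨x, hx⟩ := exists_falsifying _ _ hcon
    have := Shape.eval_label_eq_false_of_not_orLeaf (x := x) hi hor fun m hm hmi =>
      hx m (Finset.mem_erase.2 ⟨hmi, hm⟩)
    rw [htaut x] at this
    exact absurd this (by decide)
  obtain ⟨k, hk, l, hl, hvk, hb'⟩ := hpair2
  rw [Finset.mem_erase] at hk hl
  have hne' : k ≠ l := fun h => hb' (by rw [h])
  have hi2 := s.leftPattern_subset hi
  have hj2 := s.leftPattern_subset hj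
  by_cases hkj : k = j
  · exact ⟨j, hj2, i, hi2, j, hj2, l, hl.2, hne.symm, by rwa [← hkj], hne.symm,
      by rwa [← hkj], hl.1.symm, hv.symm, by rwa [← hkj]⟩
  · by_cases hlj : l = j
    · exact ⟨j, hj2, i, hi2, j, hj2, k, hk.2, hne.symm, Ne.symm hkj, hne.symm, Ne.symm hkj,
        hk.1.symm, hv.symm, by rw [hvk, hlj]⟩
    · exact ⟨i, hi2, j, hj2, k, hk.2, l, hl.2, hne, hl.1.symm, hkj, hne', Ne.symm hlj, hv, hvk⟩

/-- The pattern of coincidences of variables and of literals in a family of literals. -/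
def coincidences {ι : Type*} (v : ι → ℕ × Bool) : ι → ι → Prop × Prop :=
  fun i j => ((v i).1 = (v j).1, v i = v j)

/-- The number of distinct variables in a finite family of literals. -/
def numVars {ι : Type*} [Fintype ι] (v : ι → ℕ × Bool) : ℕ :=
  (Finset.univ.image fun i => (v i).1).card

/-- The coincidence patterns of families of literals with at most `K` variables. -/
def patterns (ι : Type*) [Fintype ι] (K : ℕ) : Set (ι → ι → Prop × Prop) :=
  coincidences '' {v | numVars v ≤ K}

/-- The coincidence patterns of families of literals with at least `R` and at most `K`
variables. -/
def patternsBetween (ι : Type*) [Fintype ι] (R K : ℕ) : Set (ι → ι → Prop × Prop) :=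
  coincidences '' {v | R ≤ numVars v ∧ numVars v ≤ K}

/-- The number of coincidence patterns of `m` literals with at most `K` variables. -/
noncomputable def patternCount (m K : ℕ) : ℕ := (patterns (Fin m) K).ncard

theorem coincidences_eq_iff {ι : Type*} {v w : ι → ℕ × Bool} :
    coincidences v = coincidences w ↔
      ∀ i j, ((v i).1 = (v j).1 ↔ (w i).1 = (w j).1) ∧ (v i = v j ↔ w i = w j) := by
  simp only [funext_iff, coincidences, Prod.mk.injEq, eq_iff_iff]

theorem numVars_comp_le {ι κ : Type*} [Fintype ι] [Fintype κ] (v : ι → ℕ × Bool) (g : κ → ι) :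
    numVars (v ∘ g) ≤ numVars v := by
  refine Finset.card_le_card fun x hx => ?_
  simp only [Finset.mem_image, Finset.mem_univ, true_and, Function.comp_apply] at hx ⊢
  obtain ⟨i, hi⟩ := hx
  exact ⟨g i, hi⟩

theorem ncard_patterns_le_of_equiv {ι κ : Type*} [Fintype ι] [Fintype κ] (e : κ ≃ ι) (K : ℕ) :
    (patterns ι K).ncard ≤ (patterns κ K).ncard := by
  refine Set.ncard_le_ncard_of_injOn (fun p i j => p (e i) (e j)) ?_ ?_ (Set.toFinite _)
  · rintro _ ⟨v, hv, rfl⟩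
    exact ⟨v ∘ e, (numVars_comp_le v e).trans hv, rfl⟩
  · intro p _ q _ h
    funext i j
    simpa using congrFun (congrFun h (e.symm i)) (e.symm j)

theorem literal_eq_iff_of_shared_variables {a b c d a' b' c' d' : ℕ × Bool}
    (ha : a.1 = a'.1) (hb : b.1 = b'.1) (hc : c.1 = c'.1) (hd : d.1 = d'.1)
    (hac : a = a' ↔ c = c') (hbd : b = b' ↔ d = d') (h : a' = b' ↔ c' = d')
    (h1 : a'.1 = b'.1 ↔ c'.1 = d'.1) : a = b ↔ c = d := by
  obtain ⟨a, x⟩ := a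
  obtain ⟨b, y⟩ := b
  obtain ⟨c, z⟩ := c
  obtain ⟨d, t⟩ := d
  obtain ⟨a', x'⟩ := a'
  obtain ⟨b', y'⟩ := b'
  obtain ⟨c', z'⟩ := c'
  obtain ⟨d', t'⟩ := d'
  simp only at ha hb hc hd h1
  subst ha hb hc hd
  simp only [Prod.mk.injEq, true_and] at *
  by_cases hab : a = b
  · have hcd := h1.1 hab
    simp only [hab, hcd, true_and] at *
    revert hac hbd h
    cases x <;> cases y <;> cases z <;> cases t <;> cases x' <;> cases y' <;> cases z' <;>
      cases t' <;> decide
  · have hcd : c ≠ d := fun h => hab (h1.2 h)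
    simp [hab, hcd]

theorem ncard_patterns_two_repetitions_le {n K : ℕ} {i j k l : Fin (n + 2)} (hij : i ≠ j)
    (hil : i ≠ l) (hkj : k ≠ j) (hkl : k ≠ l) (hjl : j ≠ l) :
    (coincidences '' {v : Fin (n + 2) → ℕ × Bool |
      numVars v ≤ K ∧ (v i).1 = (v j).1 ∧ (v k).1 = (v l).1}).ncard ≤ patternCount n K * 4 := by
  classical
  let κ := {x : Fin (n + 2) // x ∉ ({j, l} : Finset (Fin (n + 2)))}
  have hcard : Fintype.card κ = n := by
    rw [Fintype.card_subtype_compl, Fintype.card_coe, Finset.card_pair hjl, Fintype.card_fin,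
      Nat.add_sub_cancel]
  have hκ : (patterns κ K).ncard ≤ patternCount n K :=
    ncard_patterns_le_of_equiv (Fintype.equivFinOfCardEq hcard).symm K
  have hprod : (patterns κ K ×ˢ (Set.univ : Set (Prop × Prop))).ncard =
      (patterns κ K).ncard * 4 := by
    rw [Set.ncard_prod, Set.ncard_univ, Nat.card_eq_fintype_card]
    simp
  refine le_trans ?_ (hprod.le.trans (Nat.mul_le_mul_right 4 hκ))
  refine Set.ncard_le_ncard_of_injOn
    (fun p => (fun x y : κ => p x y, (p i j).2, (p k l).2)) ?_ ?_ (Set.toFinite _)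
  · rintro _ ⟨v, ⟨hv, -⟩, rfl⟩
    exact ⟨⟨v ∘ Subtype.val, (numVars_comp_le v _).trans hv, rfl⟩, trivial⟩
  · rintro _ ⟨v, ⟨-, hv1, hv2⟩, rfl⟩ _ ⟨w, ⟨-, hw1, hw2⟩, rfl⟩ h
    simp only [Prod.mk.injEq] at h
    obtain ⟨hκ', hb1, hb2⟩ := h
    simp only [coincidences, eq_iff_iff] at hb1 hb2
    have hrep : ∀ x, ∃ y : κ, (v x).1 = (v y).1 ∧ (w x).1 = (w y).1 ∧
        (v x = v y ↔ w x = w y) := by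
      intro x
      by_cases hxj : x = j
      · exact ⟨⟨i, by simp [hij, hil]⟩, by simp [hxj, hv1], by simp [hxj, hw1], by
          rw [hxj, eq_comm, hb1, eq_comm]⟩
      · by_cases hxl : x = l
        · exact ⟨⟨k, by simp [hkj, hkl]⟩, by simp [hxl, hv2], by simp [hxl, hw2], by
            rw [hxl, eq_comm, hb2, eq_comm]⟩
        · exact ⟨⟨x, by simp [hxj, hxl]⟩, rfl, rfl, by simp⟩
    rw [coincidences_eq_iff]
    intro x y
    obtain ⟨x', hx1, hx2, hx3⟩ := hrep x
    obtain ⟨y', hy1, hy2, hy3⟩ := hrep y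
    have hxy := congrFun (congrFun hκ' x') y'
    simp only [coincidences, Prod.mk.injEq, eq_iff_iff] at hxy
    exact ⟨by rw [hx1, hx2, hy1, hy2]; exact hxy.1,
      literal_eq_iff_of_shared_variables hx1 hy1 hx2 hy2 hx3 hy3 hxy.2 hxy.1⟩

theorem mul_ncard_patternsBetween_le (m R K : ℕ) :
    (patternsBetween (Fin m) R K).ncard * R ≤ (patternsBetween (Fin (m + 1)) R K).ncard := by
  have hex : ∀ p ∈ patternsBetween (Fin m) R K, ∃ (v : Fin m → ℕ × Bool) (e : Fin R → ℕ),
      R ≤ numVars v ∧ numVars v ≤ K ∧ coincidences v = p ∧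
      Function.Injective e ∧ ∀ a, ∃ i, (v i).1 = e a := by
    rintro _ ⟨v, ⟨hR, hK⟩, rfl⟩
    let X := Finset.univ.image fun i => (v i).1
    refine ⟨v, fun a => X.equivFin.symm (Fin.castLE hR a), hR, hK, rfl, fun a b h => ?_,
      fun a => ?_⟩
    · exact Fin.castLE_injective hR (X.equivFin.symm.injective (Subtype.ext h))
    · simpa only [X, Finset.mem_image, Finset.mem_univ, true_and] using
        (X.equivFin.symm (Fin.castLE hR a)).2
  choose! v e hR hK hp he hve using hex
  have hprod : (patternsBetween (Fin m) R K ×ˢ (Set.univ : Set (Fin R))).ncard =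
      (patternsBetween (Fin m) R K).ncard * R := by
    rw [Set.ncard_prod, Set.ncard_univ, Nat.card_eq_fintype_card, Fintype.card_fin]
  rw [← hprod]
  refine Set.ncard_le_ncard_of_injOn (fun q => coincidences
    (Fin.cons (e q.1 q.2, true) (v q.1) : Fin (m + 1) → ℕ × Bool)) ?_ ?_ (Set.toFinite _)
  · rintro ⟨p, a⟩ ⟨hpm, -⟩
    have : numVars (Fin.cons (e p a, true) (v p) : Fin (m + 1) → ℕ × Bool) =
        numVars (v p) := by
      unfold numVars
      congr 1
      ext x
      simp only [Finset.mem_image, Finset.mem_univ, true_and, Fin.exists_fin_succ, Fin.cons_zero,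
        Fin.cons_succ, or_iff_right_iff_imp]
      rintro rfl
      exact hve p hpm a
    exact ⟨_, ⟨by rw [this]; exact hR p hpm, by rw [this]; exact hK p hpm⟩, rfl⟩
  · rintro ⟨p, a⟩ ⟨hpm, -⟩ ⟨q, b⟩ ⟨hqm, -⟩ h
    simp only [coincidences_eq_iff] at h
    have hpq : p = q := by
      rw [← hp p hpm, ← hp q hqm, coincidences_eq_iff]
      intro i j
      simpa using h i.succ j.succ
    subst hpq
    obtain ⟨i, hi⟩ := hve p hpm a
    have := (h 0 i.succ).1
    simp only [Fin.cons_zero, Fin.cons_succ, hi, true_iff] at this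
    rw [he p hpm this]

theorem pow_le_ncard_patternsBetween {R K : ℕ} (hRK : R ≤ K) (d : ℕ) :
    R ^ d ≤ (patternsBetween (Fin (R + d)) R K).ncard := by
  induction d with
  | zero =>
    rw [pow_zero, Nat.one_le_iff_ne_zero, ← Nat.pos_iff_ne_zero, Set.ncard_pos (Set.toFinite _)]
    refine ⟨_, fun i => (i, true), ?_, rfl⟩
    have : numVars (fun i : Fin R => ((i : ℕ), true)) = R := by
      rw [numVars, Finset.card_image_of_injective _ Fin.val_injective]
      simp
    simpa [this] using hRK
  | succ d ih =>
    rw [pow_succ]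
    exact (Nat.mul_le_mul_right R ih).trans (mul_ncard_patternsBetween_le _ _ _)

theorem patternCount_le_pow (R m : ℕ) : patternCount m R ≤ (2 * R) ^ m := by
  have hsub : patterns (Fin m) R ⊆ (fun w : Fin m → Fin R × Bool =>
      coincidences fun i => (((w i).1 : ℕ), (w i).2)) '' Set.univ := by
    rintro _ ⟨v, hv, rfl⟩
    let X := Finset.univ.image fun i => (v i).1
    have hv : X.card ≤ R := hv
    have hX : ∀ i, (v i).1 ∈ X := fun i => Finset.mem_image_of_mem _ (Finset.mem_univ i)
    refine ⟨fun i => (Fin.castLE hv (X.equivFin ⟨(v i).1, hX i⟩), (v i).2), trivial, ?_⟩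
    rw [coincidences_eq_iff]
    intro i j
    have hij : Fin.castLE hv (X.equivFin ⟨(v i).1, hX i⟩) =
        Fin.castLE hv (X.equivFin ⟨(v j).1, hX j⟩) ↔ (v i).1 = (v j).1 := by
      rw [(Fin.castLE_injective hv).eq_iff, X.equivFin.injective.eq_iff, Subtype.mk.injEq]
    simp only [Prod.ext_iff, Fin.val_inj, hij, and_self]
  refine (Set.ncard_le_ncard hsub (Set.toFinite _)).trans ((Set.ncard_image_le).trans ?_)
  rw [Set.ncard_univ, Nat.card_eq_fintype_card]
  simp [mul_comm]

theorem exists_mul_patternCount_le {R : ℕ} (hR : 0 < R) : ∃ m₀, ∀ m ≥ m₀, ∀ K ≥ 4 * R,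
    R * patternCount m K ≤ 2 * patternCount (m + 1) K := by
  refine ⟨4 * R + (2 * R) ^ (4 * R), fun m hm K hK => ?_⟩
  obtain ⟨d, rfl⟩ : ∃ d, m = 4 * R + d := ⟨m - 4 * R, by omega⟩
  have hd : (2 * R) ^ (4 * R) ≤ d := by omega
  have hsmall : patternCount (4 * R + d) R ≤
      (patternsBetween (Fin (4 * R + d)) R K).ncard := by
    calc patternCount (4 * R + d) R ≤ (2 * R) ^ (4 * R + d) := patternCount_le_pow R _
      _ = (2 * R) ^ (4 * R) * (2 * R) ^ d := pow_add _ _ _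
      _ ≤ 2 ^ d * (2 * R) ^ d := Nat.mul_le_mul_right _ (hd.trans Nat.lt_two_pow_self.le)
      _ = (4 * R) ^ d := by rw [← mul_pow]; ring
      _ ≤ (patternsBetween (Fin (4 * R + d)) (4 * R) K).ncard :=
          pow_le_ncard_patternsBetween hK d
      _ ≤ _ := Set.ncard_le_ncard
          (Set.image_mono fun v (hv : 4 * R ≤ numVars v ∧ numVars v ≤ K) =>
            (⟨le_trans (by omega) hv.1, hv.2⟩ : R ≤ numVars v ∧ numVars v ≤ K)) (Set.toFinite _)
  have hle : patternCount (4 * R + d) K ≤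
      patternCount (4 * R + d) R + (patternsBetween (Fin (4 * R + d)) R K).ncard := by
    refine le_trans (Set.ncard_le_ncard ?_ (Set.toFinite _)) (Set.ncard_union_le _ _)
    rintro _ ⟨v, hv, rfl⟩
    rcases le_total (numVars v) R with h | h
    · exact Or.inl ⟨v, h, rfl⟩
    · exact Or.inr ⟨v, ⟨h, hv⟩, rfl⟩
  have hgrow := mul_ncard_patternsBetween_le (4 * R + d) R K
  have hsub : (patternsBetween (Fin (4 * R + d + 1)) R K).ncard ≤
      patternCount (4 * R + d + 1) K :=
    Set.ncard_le_ncard (Set.image_mono fun v hv => hv.2) (Set.toFinite _)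
  nlinarith

theorem patternCount_pos (m : ℕ) {K : ℕ} (hK : 0 < K) : 0 < patternCount m K := by
  refine (Set.ncard_pos (Set.toFinite _)).2 ⟨_, fun _ => (0, true), ?_, rfl⟩
  refine le_trans (Finset.card_le_card (t := {0}) ?_) hK
  intro x hx
  obtain ⟨i, -, rfl⟩ := Finset.mem_image.1 hx
  exact Finset.mem_singleton_self 0

/-- The tree-structure of a tree together with the coincidence pattern of its first `n` leaves. -/
def treeClass (n : ℕ) (t : AOTree) : Shape × (Fin n → Fin n → Prop × Prop) :=
  (t.shape, coincidences fun i : Fin n => lv t i)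

theorem treeEquiv_iff_treeClass_eq {n : ℕ} {A B : AOTree} (hA : A.size = n) :
    TreeEquiv A B ↔ treeClass n A = treeClass n B := by
  subst hA
  rw [treeClass, treeClass, Prod.mk.injEq, coincidences_eq_iff]
  exact and_congr_right fun _ => ⟨fun h i j => h i j i.2 j.2,
    fun h i j hi hj => h ⟨i, hi⟩ ⟨j, hj⟩⟩

theorem classCount_eq_ncard {n : ℕ} {P : AOTree → Prop} (hP : ∀ t, P t → t.size = n) :
    classCount P = (treeClass n '' {t | P t}).ncard := by
  rw [classCount, ← Nat.card_coe_set_eq]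
  refine Nat.card_congr (Equiv.ofBijective (Quot.lift
    (fun t => ⟨treeClass n t.1, t.1, t.2, rfl⟩) fun A B h => Subtype.ext
      ((treeEquiv_iff_treeClass_eq (hP _ A.2)).1 h)) ⟨?_, ?_⟩)
  · rintro ⟨A⟩ ⟨B⟩ h
    exact Quot.sound ((treeEquiv_iff_treeClass_eq (hP _ A.2)).2 (Subtype.ext_iff.1 h))
  · rintro ⟨_, t, ht, rfl⟩
    exact ⟨Quot.mk _ ⟨t, ht⟩, rfl⟩

theorem varCount_eq_numVars {n : ℕ} {t : AOTree} (ht : t.size = n) :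
    t.varCount = numVars fun i : Fin n => lv t i := by
  subst ht
  unfold AOTree.varCount numVars
  congr 1
  ext x
  simp only [List.mem_toFinset, List.mem_map, Finset.mem_image, Finset.mem_univ, true_and]
  constructor
  · rintro ⟨a, ha, rfl⟩
    obtain ⟨i, hi, rfl⟩ := List.getElem_of_mem ha
    exact ⟨⟨i, hi⟩, by rw [lv, List.getD_eq_getElem _ _ hi]⟩
  · rintro ⟨i, rfl⟩
    exact ⟨_, List.getElem_mem i.2, by rw [lv, List.getD_eq_getElem _ _ i.2]⟩

theorem finite_treeClass_image {n : ℕ} {P : AOTree → Prop} (hP : ∀ t, P t → t.size = n) :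
    (treeClass n '' {t | P t}).Finite := by
  refine ((Shape.finite_size n).prod (Set.finite_univ)).subset ?_
  rintro _ ⟨t, ht, rfl⟩
  exact ⟨by rw [Set.mem_ofPred_eq, ← hP t ht]; exact t.size_shape, trivial⟩

theorem IsSimpleTautology.isTautology {t : AOTree} (ht : IsSimpleTautology t) :
    IsTautology t := by
  have key : ∀ (t : AOTree) (v : ℕ) (b : Bool) (x : ℕ → Bool), orLeaf t (v, b) → x v = b →
      t.eval x = true := by
    intro t v b x h hx
    induction t with
    | leaf w c =>
      obtain ⟨rfl, rfl⟩ := Prod.mk.inj h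
      cases c <;> simp [AOTree.eval, hx]
    | node c l r hl hr =>
      cases c
      · exact h.elim
      · rcases h with h | h
        · simp [AOTree.eval, hl h]
        · simp [AOTree.eval, hr h]
  obtain ⟨v, b, h1, h2⟩ := ht
  intro x
  by_cases hx : x v = b
  · exact key t v b x h1 hx
  · exact key t v (!b) x h2 (by cases b <;> simp_all)

theorem mul_patternCount_le_classCount (n K : ℕ) :
    (shapesOfSize (n + 1)).card * patternCount (n + 2) K ≤
      classCount fun t => t.size = n + 3 ∧ t.varCount ≤ K ∧ IsSimpleTautology t := by
  rw [classCount_eq_ncard (n := n + 3) fun t ht => ht.1]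
  have hex : ∀ p ∈ patterns (Fin (n + 2)) K, ∃ v : Fin (n + 2) → ℕ × Bool,
      numVars v ≤ K ∧ coincidences v = p := fun p hp => hp
  choose! v hvK hvp using hex
  rw [patternCount, ← Set.ncard_coe_finset, ← Set.ncard_prod]
  let w : (Fin (n + 2) → Fin (n + 2) → Prop × Prop) → ℕ → ℕ × Bool := fun p i =>
    match i with
    | 0 => v p 0
    | 1 => ((v p 0).1, !(v p 0).2)
    | i + 2 => if h : i + 1 < n + 2 then v p ⟨i + 1, h⟩ else (0, true)
  let g : Fin (n + 2) → Fin (n + 3) := Fin.cases 0 fun i => i.succ.succ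
  let S : Shape → Shape := fun s => .node .or .leaf (.node .or .leaf s)
  have hsize : ∀ s ∈ shapesOfSize (n + 1), (S s).size = n + 3 := fun s hs => by
    simp only [S, Shape.size, mem_shapesOfSize.1 hs]; omega
  have hwg : ∀ p i, w p (g i) = v p i := by
    intro p i
    refine Fin.cases rfl (fun i => ?_) i
    have : (i : ℕ) + 1 < n + 2 := by omega
    exact dif_pos this
  have hlabel : ∀ s ∈ shapesOfSize (n + 1), ∀ p,
      (fun i : Fin (n + 3) => lv ((S s).label (w p)) i) = fun i : Fin (n + 3) => w p i :=
    fun s hs p => funext fun i => Shape.lv_label _ _ (by rw [hsize s hs]; exact i.2)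
  refine Set.ncard_le_ncard_of_injOn (fun q => treeClass (n + 3) ((S q.1).label (w q.2))) ?_ ?_
    (finite_treeClass_image fun t ht => ht.1)
  · rintro ⟨s, p⟩ ⟨hs, hp⟩
    refine ⟨_, ⟨(Shape.size_label _ _).trans (hsize s hs), ?_, ?_⟩, rfl⟩
    · rw [varCount_eq_numVars ((Shape.size_label _ _).trans (hsize s hs)), hlabel s hs]
      refine le_trans (Finset.card_le_card fun x hx => ?_) (hvK p hp)
      simp only [Finset.mem_image, Finset.mem_univ, true_and] at hx ⊢
      obtain ⟨⟨i, hi⟩, rfl⟩ := hx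
      match i, hi with
      | 0, _ => exact ⟨0, rfl⟩
      | 1, _ => exact ⟨0, rfl⟩
      | i + 2, hi =>
        exact ⟨⟨i + 1, by omega⟩, by
          simp only [w]
          rw [dif_pos (show i + 1 < n + 2 by omega)]⟩
    · exact ⟨(v p 0).1, (v p 0).2, Or.inl rfl, Or.inr (Or.inl rfl)⟩
  · rintro ⟨s, p⟩ ⟨hs, hp⟩ ⟨s', p'⟩ ⟨hs', hp'⟩ h
    simp only [treeClass, Prod.mk.injEq, Shape.shape_label] at h
    obtain ⟨hS, hc⟩ := h
    rw [hlabel s hs, hlabel s' hs', coincidences_eq_iff] at hc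
    have hss : s = s' := by simpa [S] using hS
    have hpp : p = p' := by
      rw [← hvp p hp, ← hvp p' hp', coincidences_eq_iff]
      intro i j
      simpa only [hwg] using hc (g i) (g j)
    rw [hss, hpp]

theorem exists_nonsimple_classCount_le : ∃ C : ℝ, ∀ n K : ℕ,
    ((classCount fun t => t.size = n + 2 ∧ t.varCount ≤ K ∧ IsTautology t ∧
      ¬ IsSimpleTautology t : ℕ) : ℝ) ≤ C * shapeCount (n + 2) * patternCount n K := by
  classical
  obtain ⟨-, C, hC⟩ := boundedMean_card_leftPattern₂_pow 4
  refine ⟨4 * C, fun n K => ?_⟩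
  rw [classCount_eq_ncard (n := n + 2) fun t ht => ht.1]
  let Q : Finset (Fin (n + 2) × Fin (n + 2) × Fin (n + 2) × Fin (n + 2)) :=
    Finset.univ.filter fun q => q.1 ≠ q.2.1 ∧ q.1 ≠ q.2.2.2 ∧ q.2.2.1 ≠ q.2.1 ∧
      q.2.2.1 ≠ q.2.2.2 ∧ q.2.1 ≠ q.2.2.2
  let D : Shape → Finset (Fin (n + 2)) := fun s =>
    Finset.univ.filter fun i => (i : ℕ) ∈ s.leftPattern₂
  let E : Shape → Finset (Fin (n + 2) × Fin (n + 2) × Fin (n + 2) × Fin (n + 2)) := fun s =>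
    (D s ×ˢ D s ×ˢ D s ×ˢ D s) ∩ Q
  let W : Fin (n + 2) × Fin (n + 2) × Fin (n + 2) × Fin (n + 2) →
      Set (Fin (n + 2) → Fin (n + 2) → Prop × Prop) := fun q =>
    coincidences '' {v | numVars v ≤ K ∧ (v q.1).1 = (v q.2.1).1 ∧ (v q.2.2.1).1 = (v q.2.2.2).1}
  have hW : ∀ q ∈ Q, (W q).ncard ≤ patternCount n K * 4 := by
    intro q hq
    simp only [Q, Finset.mem_filter, Finset.mem_univ, true_and] at hq
    obtain ⟨h1, h2, h3, h4, h5⟩ := hq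
    exact ncard_patterns_two_repetitions_le h1 h2 h3 h4 h5
  have hD : ∀ s, (D s).card ≤ s.leftPattern₂.card := fun s =>
    Finset.card_le_card_of_injOn (fun i => (i : ℕ))
      (fun i hi => (Finset.mem_filter.1 hi).2) Fin.val_injective.injOn
  have hE : ∀ s, (E s).card ≤ s.leftPattern₂.card ^ 4 := fun s =>
    calc (E s).card ≤ (D s ×ˢ D s ×ˢ D s ×ˢ D s).card :=
          Finset.card_le_card Finset.inter_subset_left
      _ = (D s).card ^ 4 := by simp only [Finset.card_product]; ring
      _ ≤ _ := Nat.pow_le_pow_left (hD s) 4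
  have hcover : treeClass (n + 2) '' {t | t.size = n + 2 ∧ t.varCount ≤ K ∧ IsTautology t ∧
      ¬ IsSimpleTautology t} ⊆
      ⋃ s ∈ shapesOfSize (n + 2), ⋃ q ∈ E s, Prod.mk s '' W q := by
    rintro _ ⟨t, ⟨hsize, hK, htaut, hsimple⟩, rfl⟩
    have hs : t.shape.size = n + 2 := t.size_shape.trans hsize
    rw [← t.label_lv] at htaut hsimple
    obtain ⟨i, hi, j, hj, k, hk, l, hl, h1, h2, h3, h4, h5, h6, h7⟩ :=
      exists_two_repetitions htaut hsimple
    have hlt : ∀ m ∈ t.shape.leftPattern₂, m < n + 2 := fun m hm =>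
      hs ▸ Shape.lt_size_of_mem_leftPattern₂ hm
    simp only [Set.mem_iUnion]
    refine ⟨t.shape, mem_shapesOfSize.2 hs,
      (⟨i, hlt i hi⟩, ⟨j, hlt j hj⟩, ⟨k, hlt k hk⟩, ⟨l, hlt l hl⟩), ?_, _,
      ⟨fun i : Fin (n + 2) => lv t i, ⟨?_, h6, h7⟩, rfl⟩, rfl⟩
    · simp only [E, D, Q, Finset.mem_inter, Finset.mem_product, Finset.mem_filter,
        Finset.mem_univ, true_and, ne_eq, Fin.mk.injEq]
      exact ⟨⟨hi, hj, hk, hl⟩, h1, h2, h3, h4, h5⟩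
    · rwa [← varCount_eq_numVars hsize]
  have hfin : (⋃ s ∈ shapesOfSize (n + 2), ⋃ q ∈ E s, Prod.mk s '' W q).Finite :=
    Set.Finite.biUnion (Finset.finite_toSet _) fun s _ =>
      Set.Finite.biUnion (Finset.finite_toSet _) fun q _ => (Set.toFinite _).image _
  have hnat : (treeClass (n + 2) '' {t | t.size = n + 2 ∧ t.varCount ≤ K ∧ IsTautology t ∧
      ¬ IsSimpleTautology t}).ncard ≤
      ∑ s ∈ shapesOfSize (n + 2), s.leftPattern₂.card ^ 4 * (patternCount n K * 4) := by
    refine (Set.ncard_le_ncard hcover hfin).trans ((Finset.set_ncard_biUnion_le _ _).trans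
      (Finset.sum_le_sum fun s _ => (Finset.set_ncard_biUnion_le _ _).trans ?_))
    calc ∑ q ∈ E s, (Prod.mk s '' W q).ncard ≤ ∑ q ∈ E s, patternCount n K * 4 :=
          Finset.sum_le_sum fun q hq => (Set.ncard_image_le (Set.toFinite _)).trans
            (hW q (Finset.mem_inter.1 hq).2)
      _ = (E s).card * (patternCount n K * 4) := by simp
      _ ≤ _ := Nat.mul_le_mul_right _ (hE s)
  have hreal : ((treeClass (n + 2) '' {t | t.size = n + 2 ∧ t.varCount ≤ K ∧ IsTautology t ∧
      ¬ IsSimpleTautology t}).ncard : ℝ) ≤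
      (∑ s ∈ shapesOfSize (n + 2), (s.leftPattern₂.card : ℝ) ^ 4) * (patternCount n K * 4) := by
    rw [Finset.sum_mul]
    exact_mod_cast hnat
  refine hreal.trans ?_
  have := mul_le_mul_of_nonneg_right (hC (n + 2))
    (show (0 : ℝ) ≤ patternCount n K * 4 by positivity)
  linarith

theorem classCount_simple_le (n K : ℕ) :
    (classCount fun t => t.size = n ∧ t.varCount ≤ K ∧ IsSimpleTautology t) ≤
      classCount fun t => t.size = n ∧ t.varCount ≤ K ∧ IsTautology t := by
  rw [classCount_eq_ncard (n := n) fun t ht => ht.1, classCount_eq_ncard (n := n) fun t ht => ht.1]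
  exact Set.ncard_le_ncard
    (Set.image_mono fun t (ht : t.size = n ∧ t.varCount ≤ K ∧ IsSimpleTautology t) =>
      (⟨ht.1, ht.2.1, ht.2.2.isTautology⟩ : t.size = n ∧ t.varCount ≤ K ∧ IsTautology t))
    (finite_treeClass_image fun t ht => ht.1)

theorem classCount_tautology_le (n K : ℕ) :
    (classCount fun t => t.size = n ∧ t.varCount ≤ K ∧ IsTautology t) ≤
      (classCount fun t => t.size = n ∧ t.varCount ≤ K ∧ IsSimpleTautology t) +
      classCount fun t => t.size = n ∧ t.varCount ≤ K ∧ IsTautology t ∧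
        ¬ IsSimpleTautology t := by
  rw [classCount_eq_ncard (n := n) fun t ht => ht.1, classCount_eq_ncard (n := n) fun t ht => ht.1,
    classCount_eq_ncard (n := n) fun t ht => ht.1]
  refine le_trans (Set.ncard_le_ncard ?_ ((finite_treeClass_image fun t ht => ht.1).union
    (finite_treeClass_image fun t ht => ht.1))) (Set.ncard_union_le _ _)
  rintro _ ⟨t, ⟨h1, h2, h3⟩, rfl⟩
  by_cases ht : IsSimpleTautology t
  · exact Or.inl ⟨t, ⟨h1, h2, ht⟩, rfl⟩
  · exact Or.inr ⟨t, ⟨h1, h2, h3, ht⟩, rfl⟩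

/-- For large sizes and bounds on the number of variables, non-simple tautologies are few
compared to simple ones. -/
theorem exists_nonsimple_le_mul_simple : ∃ C : ℝ, 0 < C ∧ ∀ R : ℕ, 0 < R → ∃ N, ∀ n ≥ N,
    ∀ K ≥ 4 * R,
      0 < (classCount fun t => t.size = n ∧ t.varCount ≤ K ∧ IsSimpleTautology t) ∧
      R * ((classCount fun t => t.size = n ∧ t.varCount ≤ K ∧ IsTautology t ∧
        ¬ IsSimpleTautology t : ℕ) : ℝ) ≤
      C * ((classCount fun t => t.size = n ∧ t.varCount ≤ K ∧ IsSimpleTautology t : ℕ) : ℝ) := by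
  obtain ⟨C, hC⟩ := exists_nonsimple_classCount_le
  refine ⟨128 * (|C| + 1), by positivity, fun R hR => ?_⟩
  obtain ⟨m₀, hm₀⟩ := exists_mul_patternCount_le hR
  refine ⟨m₀ + 3, fun n hn K hK => ?_⟩
  obtain ⟨n, rfl⟩ : ∃ n', n = n' + 3 := ⟨n - 3, by omega⟩
  have hlow : shapeCount (n + 1) * (patternCount (n + 2) K : ℝ) ≤
      ((classCount fun t => t.size = n + 3 ∧ t.varCount ≤ K ∧ IsSimpleTautology t : ℕ) : ℝ) := by
    unfold shapeCount
    exact_mod_cast mul_patternCount_le_classCount n K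
  have hpos : (0 : ℝ) < patternCount (n + 2) K := by
    exact_mod_cast patternCount_pos (n + 2) (show 0 < K by omega)
  have hratio : (R : ℝ) * patternCount (n + 1) K ≤ 2 * patternCount (n + 2) K := by
    exact_mod_cast hm₀ (n + 1) (by omega) K hK
  have hshape : shapeCount (n + 3) ≤ 64 * shapeCount (n + 1) := by
    linarith [shapeCount_le_mul (n + 1), shapeCount_le_mul n]
  have hc := shapeCount_pos n
  refine ⟨by exact_mod_cast (mul_pos hc hpos).trans_le hlow, ?_⟩
  have hL : (0 : ℝ) ≤ patternCount (n + 1) K := Nat.cast_nonneg _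
  calc (R : ℝ) * _ ≤ R * (C * shapeCount (n + 3) * patternCount (n + 1) K) := by
        gcongr; exact hC (n + 1) K
    _ ≤ R * ((|C| + 1) * (64 * shapeCount (n + 1)) * patternCount (n + 1) K) := by
        gcongr
        · exact shapeCount_nonneg _
        · linarith [le_abs_self C]
    _ = (64 * (|C| + 1)) * shapeCount (n + 1) * (R * patternCount (n + 1) K) := by ring
    _ ≤ (64 * (|C| + 1)) * shapeCount (n + 1) * (2 * patternCount (n + 2) K) := by gcongr
    _ = 128 * (|C| + 1) * (shapeCount (n + 1) * patternCount (n + 2) K) := by ring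
    _ ≤ _ := by gcongr

/-- asymptotically, almost all tautologies are simple
tautologies: `ST_n/A_n → 1`. -/
theorem stmt_12 (k : ℕ → ℕ) (hk_mono : Monotone k)
    (hk_pos : ∀ n, 1 ≤ n → 1 ≤ k n) (hk_le : ∀ n, 1 ≤ n → k n ≤ n)
    (hk_tend : Tendsto k atTop atTop) :
    Tendsto
      (fun n =>
        ((classCount fun t =>
            t.size = n ∧ t.varCount ≤ k n ∧ IsSimpleTautology t : ℕ) : ℝ)
          / ((classCount fun t =>
            t.size = n ∧ t.varCount ≤ k n ∧ IsTautology t : ℕ) : ℝ))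
      atTop (nhds 1) := by
  obtain ⟨C, hC0, hC⟩ := exists_nonsimple_le_mul_simple
  rw [Metric.tendsto_nhds]
  intro ε hε
  obtain ⟨R, hR⟩ := exists_nat_gt (C / ε)
  have hR0 : (0 : ℝ) < R := (div_pos hC0 hε).trans hR
  obtain ⟨N, hN⟩ := hC R (by exact_mod_cast hR0)
  filter_upwards [eventually_ge_atTop N, hk_tend.eventually_ge_atTop (4 * R)] with n hn hkn
  obtain ⟨hS0, hNS⟩ := hN n hn (k n) hkn
  have hSA : ((classCount fun t => t.size = n ∧ t.varCount ≤ k n ∧ IsSimpleTautology t : ℕ) : ℝ) ≤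
      ((classCount fun t => t.size = n ∧ t.varCount ≤ k n ∧ IsTautology t : ℕ) : ℝ) :=
    Nat.cast_le.mpr (classCount_simple_le n (k n))
  have hAS : ((classCount fun t => t.size = n ∧ t.varCount ≤ k n ∧ IsTautology t : ℕ) : ℝ) ≤ _ :=
    Nat.cast_le.mpr (classCount_tautology_le n (k n))
  rw [Nat.cast_add] at hAS
  have hS0' := Nat.cast_pos (α := ℝ).mpr hS0
  generalize ((classCount fun t => t.size = n ∧ t.varCount ≤ k n ∧
    IsSimpleTautology t : ℕ) : ℝ) = S at *
  generalize ((classCount fun t => t.size = n ∧ t.varCount ≤ k n ∧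
    IsTautology t : ℕ) : ℝ) = A at *
  generalize ((classCount fun t => t.size = n ∧ t.varCount ≤ k n ∧ IsTautology t ∧
    ¬ IsSimpleTautology t : ℕ) : ℝ) = D at *
  have hA0 : 0 < A := hS0'.trans_le hSA
  have hD : D < ε * S := by
    rw [div_lt_iff₀ hε] at hR
    nlinarith
  rw [Real.dist_eq, abs_sub_lt_iff, sub_lt_iff_lt_add, div_lt_iff₀ hA0, sub_lt_comm,
    lt_div_iff₀ hA0]
  constructor <;> nlinarith

end CatalanSat
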